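/- Let α ∈ (0,1) and let g : (0,∞) → ℝ be such that g and y ↦ y·g(y) belong to L¹(0,∞) and g has compact support; set m = ∫_0^∞ g(y) dy. Then for all t > 1, ‖w_1(·,t)‖_{L^∞(0,∞)} ≤ C_2(α)·t^{−2/(1+α)}·‖y g(y)‖_{L¹(0,∞)} and ‖w_2(·,t) − 2m·𝔈_t(·)‖_{L^∞(0,∞)} ≤ C_2(α)·t^{−2/(1+α)}·‖y g(y)‖_{L¹(0,∞)}, where C_2(α) = 2 a_0 C_1(α). -/

import Mathlib

open Real MeasureTheory Set Filter Topology

noncomputable def bCoef (α : ℝ) (n : ℕ) : ℝ :=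
  ∏ i ∈ Finset.range n, Real.Gamma (α * i + i + 2) / Real.Gamma (α * (i + 1) + i + 2)

/-- The profile function `Φ(x) = ∑ bₙ (−x^{1+α}/(1+α))ⁿ`. -/
noncomputable def Phi (α : ℝ) (x : ℝ) : ℝ :=
  ∑' n : ℕ, bCoef α n * (-(x ^ (1 + α)) / (1 + α)) ^ n

/-- The Caputo fractional derivative of order `α`. -/
noncomputable def caputo (α : ℝ) (f : ℝ → ℝ) (x : ℝ) : ℝ :=
  (1 / Real.Gamma (1 - α)) * ∫ τ in (0:ℝ)..x, deriv f τ * (x - τ) ^ (-α)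

/-- The normalizing constant `a₀` with `1/a₀ = 2∫₀^∞ Φ`. -/
noncomputable def a0 (α : ℝ) : ℝ := (2 * ∫ x in Set.Ioi (0:ℝ), Phi α x)⁻¹

/-- The fundamental solution `𝔈_t(x) = a₀ t^{−1/(1+α)} Φ(|x| t^{−1/(1+α)})`. -/
noncomputable def fundSol (α t x : ℝ) : ℝ :=
  a0 α * t ^ (-1/(1+α)) * Phi α (|x| * t ^ (-1/(1+α)))

noncomputable def C1 (α : ℝ) : ℝ :=
  α * (2:ℝ) ^ (1+α) * max (∫ u in (1/2:ℝ)..1, u ^ (-(1+α)) * (1-u) ^ (α-1)) 2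

noncomputable def C2 (α : ℝ) : ℝ := 2 * a0 α * C1 α

/-- entire coefficient sequences -/
def Ent (a : ℕ → ℝ) : Prop := ∀ R : ℝ, 0 ≤ R → Summable fun n => |a n| * R ^ n

noncomputable def Pser (a : ℕ → ℝ) (z : ℝ) : ℝ := ∑' n, a n * z ^ n

lemma Ent.of_le {a a' : ℕ → ℝ} (ha : Ent a) (C : ℝ) (h : ∀ n, |a' n| ≤ C * 2 ^ n * |a n|) :
    Ent a' := by
  intro R hR
  refine Summable.of_nonneg_of_le (fun n => by positivity) (fun n => ?_)
    ((ha (2 * R) (by positivity)).mul_left C)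
  calc |a' n| * R ^ n ≤ (C * 2 ^ n * |a n|) * R ^ n := by gcongr; exact h n
    _ = C * (|a n| * (2 * R) ^ n) := by rw [mul_pow]; ring

lemma Ent.shift {a : ℕ → ℝ} (ha : Ent a) : Ent (fun n => a (n + 1)) := by
  intro R hR
  refine Summable.of_nonneg_of_le (fun n => by positivity) (fun n => ?_)
    ((summable_nat_add_iff 1).2 (ha (R + 1) (by positivity)))
  have : R ^ n ≤ (R + 1) ^ (n + 1) := by
    calc R ^ n ≤ (R + 1) ^ n := by gcongr; linarith
      _ ≤ (R + 1) ^ (n + 1) := pow_le_pow_right₀ (by linarith) (by omega)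
  gcongr

lemma natCast_le_two_pow (n : ℕ) : (n : ℝ) ≤ 2 ^ n := by
  exact_mod_cast (Nat.lt_two_pow_self (n := n)).le

lemma Ent.summable {a : ℕ → ℝ} (ha : Ent a) (z : ℝ) : Summable fun n => a n * z ^ n := by
  refine Summable.of_norm ?_
  simpa [abs_mul, abs_pow] using ha |z| (abs_nonneg z)

/-- multiplication by affine factor -/
lemma Ent.affine {a : ℕ → ℝ} (ha : Ent a) (p q : ℝ) : Ent (fun n => a n * (p * n + q)) := by
  refine ha.of_le (|p| + |q|) (fun n => ?_)
  have h1 := natCast_le_two_pow n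
  have h2 : (1 : ℝ) ≤ 2 ^ n := one_le_pow₀ (by norm_num)
  have : |p * n + q| ≤ (|p| + |q|) * 2 ^ n := by
    calc |p * n + q| ≤ |p * n| + |q| := abs_add_le _ _
      _ = |p| * n + |q| * 1 := by rw [abs_mul, Nat.abs_cast]; ring
      _ ≤ |p| * 2 ^ n + |q| * 2 ^ n := by gcongr
      _ = _ := by ring
  rw [abs_mul, mul_comm]
  gcongr

lemma Pser_hasDerivAt {a : ℕ → ℝ} (ha : Ent a) (z : ℝ) :
    HasDerivAt (Pser a) (Pser (fun n => a (n + 1) * (n + 1)) z) z := by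
  have hs : Ent (fun n => a (n + 1) * (n + 1)) := by
    have := (ha.shift).affine 1 1
    simpa using this
  set R := |z| + 1 with hR
  have hRpos : 0 < R := by positivity
  have hu : Summable (fun n : ℕ => |a n| * (n * R ^ (n - 1))) := by
    rw [← summable_nat_add_iff 1]
    refine (hs R hRpos.le).congr (fun n => ?_)
    simp only [Nat.add_sub_cancel, abs_mul]
    push_cast
    rw [abs_of_nonneg (by positivity : (0 : ℝ) ≤ (n : ℝ) + 1)]; ring
  have key := hasDerivAt_tsum_of_isPreconnected (𝕜 := ℝ) (F := ℝ)
    (g := fun n y => a n * y ^ n) (g' := fun n y => a n * (n * y ^ (n - 1)))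
    (t := Ioo (-R) R) (y₀ := 0) (y := z) hu isOpen_Ioo isPreconnected_Ioo
    (fun n y _ => (hasDerivAt_pow n y).const_mul (a n))
    (fun n y hy => by
      have : |y| ≤ R := abs_le.2 ⟨hy.1.le, hy.2.le⟩
      rw [norm_mul, norm_mul, norm_pow, Real.norm_eq_abs, Real.norm_eq_abs, Real.norm_eq_abs,
        Nat.abs_cast]
      gcongr)
    ⟨by linarith, hRpos⟩ (ha.summable 0)
    (by
      have := abs_lt.1 (show |z| < R by linarith)
      exact ⟨this.1, this.2⟩)
  have e : (∑' n, a n * (n * z ^ (n - 1))) = Pser (fun n => a (n + 1) * (n + 1)) z := by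
    have hsum : Summable (fun n : ℕ => a n * (n * z ^ (n - 1))) := by
      rw [← summable_nat_add_iff 1]
      refine (hs.summable z).congr (fun n => ?_)
      simp only [Nat.add_sub_cancel]; push_cast; ring
    rw [hsum.tsum_eq_zero_add]
    simp only [Pser, Nat.cast_zero, zero_mul, mul_zero, zero_add, Nat.add_sub_cancel]
    refine tsum_congr (fun n => ?_)
    push_cast; ring
  rw [e] at key
  exact key

lemma Pser_continuous {a : ℕ → ℝ} (ha : Ent a) : Continuous (Pser a) :=
  continuous_iff_continuousAt.2 fun z => (Pser_hasDerivAt ha z).continuousAt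

lemma Pser_zero (a : ℕ → ℝ) : Pser a 0 = a 0 := by
  unfold Pser
  rw [tsum_eq_single 0]
  · simp
  · intro n hn; simp [hn]

lemma Pser_eq_zero_add {a : ℕ → ℝ} (ha : Ent a) (z : ℝ) :
    Pser a z = a 0 + z * Pser (fun n => a (n + 1)) z := by
  unfold Pser
  rw [(ha.summable z).tsum_eq_zero_add, ← tsum_mul_left]
  simp only [pow_zero, mul_one]
  congr 1
  exact tsum_congr (fun n => by ring)

lemma Pser_const_mul (a : ℕ → ℝ) (c z : ℝ) : Pser (fun n => c * a n) z = c * Pser a z := by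
  unfold Pser
  rw [← tsum_mul_left]
  exact tsum_congr (fun n => by ring)

lemma Pser_affine {a : ℕ → ℝ} (ha : Ent a) (p q z : ℝ) :
    Pser (fun n => a n * (p * n + q)) z =
      p * (z * Pser (fun n => a (n + 1) * (n + 1)) z) + q * Pser a z := by
  have h1 : Ent (fun n => a n * (n : ℝ)) := by simpa using ha.affine 1 0
  have h2 := Pser_eq_zero_add h1 z
  simp only [Nat.cast_zero, mul_zero, zero_add, Nat.cast_add, Nat.cast_one] at h2
  rw [← h2]
  unfold Pser
  rw [← tsum_mul_left, ← tsum_mul_left, ← Summable.tsum_add ((h1.summable z).mul_left p)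
    ((ha.summable z).mul_left q)]
  exact tsum_congr (fun n => by ring)

noncomputable def Sser (α : ℝ) (a : ℕ → ℝ) (r x : ℝ) : ℝ := x ^ r * Pser a (x ^ (1 + α))

lemma Sser_hasDerivAt {α : ℝ} {a : ℕ → ℝ} (ha : Ent a) (r : ℝ) {x : ℝ} (hx : 0 < x) :
    HasDerivAt (Sser α a r) (Sser α (fun n => a n * ((1 + α) * n + r)) (r - 1) x) x := by
  have h1 := Real.hasDerivAt_rpow_const (x := x) (p := r) (Or.inl hx.ne')
  have h2 := Real.hasDerivAt_rpow_const (x := x) (p := 1 + α) (Or.inl hx.ne')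
  have h3 := (Pser_hasDerivAt ha (x ^ (1 + α))).comp x h2
  have h4 := h1.mul h3
  refine h4.congr_deriv ?_
  unfold Sser
  rw [Pser_affine ha]
  have e1 : x ^ r = x ^ (r - 1) * x := by
    rw [← Real.rpow_add_one hx.ne']; ring_nf
  have e2 : x ^ (1 + α) = x ^ α * x := by
    rw [← Real.rpow_add_one hx.ne']; ring_nf
  have e3 : (1 + α - 1) = α := by ring
  rw [e3]
  simp only [Function.comp]
  rw [e1]
  nth_rewrite 3 [e2]
  ring

lemma beta_integrable {p r x : ℝ} (hp : 0 < p) (hr : -1 < r) (hx : 0 < x) :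
    IntervalIntegrable (fun τ : ℝ => (x - τ) ^ (p - 1) * τ ^ r) volume 0 x := by
  refine IntervalIntegrable.trans (b := x / 2) ?_ ?_
  · apply IntervalIntegrable.continuousOn_mul
    · exact intervalIntegral.intervalIntegrable_rpow' hr
    · rw [uIcc_of_le (by positivity)]
      intro τ hτ
      have : x - τ ≠ 0 := by have := hτ.2; linarith
      exact ((continuousAt_const.sub continuousAt_id).rpow_const (Or.inl this)).continuousWithinAt
  · apply IntervalIntegrable.mul_continuousOn
    · have := (intervalIntegral.intervalIntegrable_rpow' (a := x / 2) (b := 0) (r := p - 1)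
        (by linarith)).comp_sub_left x
      convert this using 1 <;> ring
    · rw [uIcc_of_le (by linarith)]
      intro τ hτ
      have : τ ≠ 0 := by have := hτ.1; linarith
      exact (continuousAt_id.rpow_const (Or.inl this)).continuousWithinAt

lemma beta_value {p q x : ℝ} (hp : 0 < p) (hq : 0 < q) (hx : 0 < x) :
    ∫ τ in (0:ℝ)..x, (x - τ) ^ (p - 1) * τ ^ (q - 1) =
      x ^ (q + p - 1) * (Real.Gamma p * Real.Gamma q / Real.Gamma (q + p)) := by
  have h := Complex.betaIntegral_scaled (q : ℂ) (p : ℂ) hx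
  rw [Complex.betaIntegral_eq_Gamma_mul_div _ _ (by simpa) (by simpa)] at h
  have e : ∫ τ in (0:ℝ)..x, (τ : ℂ) ^ ((q : ℂ) - 1) * ((x : ℂ) - τ) ^ ((p : ℂ) - 1) =
      ∫ τ in (0:ℝ)..x, (((x - τ) ^ (p - 1) * τ ^ (q - 1) : ℝ) : ℂ) := by
    apply intervalIntegral.integral_congr
    intro τ hτ
    rw [uIcc_of_le hx.le] at hτ
    simp only
    rw [Complex.ofReal_mul, Complex.ofReal_cpow (by linarith [hτ.2]), Complex.ofReal_cpow hτ.1]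
    push_cast
    ring
  rw [e, intervalIntegral.integral_ofReal, Complex.Gamma_ofReal, Complex.Gamma_ofReal,
    ← Complex.ofReal_add, Complex.Gamma_ofReal] at h
  have e2 : ((x : ℂ) ^ (((q + p : ℝ) : ℂ) - 1)) = ((x ^ (q + p - 1) : ℝ) : ℂ) := by
    rw [Complex.ofReal_cpow hx.le]; push_cast; rfl
  rw [e2] at h
  rw [mul_comm (Real.Gamma p)]
  exact_mod_cast h

lemma Sser_kernel_integrable {α p r x : ℝ} (hα : 0 < α) {a : ℕ → ℝ} (ha : Ent a) (hp : 0 < p)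
    (hr : -1 < r) (hx : 0 < x) :
    IntervalIntegrable (fun τ : ℝ => (x - τ) ^ (p - 1) * Sser α a r τ) volume 0 x := by
  have h := (beta_integrable hp hr hx).mul_continuousOn (g := fun τ => Pser a (τ ^ (1 + α)))
    (((Pser_continuous ha).comp (Real.continuous_rpow_const (by linarith))).continuousOn)
  refine h.congr (fun τ _ => ?_)
  simp only [Sser]; ring

lemma Sser_kernel_integral {α p r x : ℝ} (hα : 0 < α) {a a' : ℕ → ℝ} (ha : Ent a) (hp : 0 < p)
    (hr : -1 < r) (hx : 0 < x)
    (haa : ∀ n, a n * (Real.Gamma p * Real.Gamma ((1 + α) * n + r + 1) /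
      Real.Gamma ((1 + α) * n + r + 1 + p)) = a' n) :
    ∫ τ in (0:ℝ)..x, (x - τ) ^ (p - 1) * Sser α a r τ = Sser α a' (r + p) x := by
  have hb : ∀ n : ℕ, IntervalIntegrable
      (fun τ : ℝ => (x - τ) ^ (p - 1) * τ ^ ((1 + α) * n + r)) volume 0 x := fun n =>
    beta_integrable hp (by have : 0 ≤ (1 + α) * n := by positivity
                           linarith) hx
  have hval : ∀ n : ℕ, ∫ τ in (0:ℝ)..x, a n * ((x - τ) ^ (p - 1) * τ ^ ((1 + α) * n + r)) =
      x ^ (r + p) * (a' n * (x ^ (1 + α)) ^ n) := by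
    intro n
    have hq : 0 < (1 + α) * n + r + 1 := by
      have : 0 ≤ (1 + α) * n := by positivity
      linarith
    have h1 := beta_value hp hq hx
    rw [show (1 + α) * n + r + 1 - 1 = (1 + α) * n + r by ring] at h1
    rw [intervalIntegral.integral_const_mul, h1, ← haa n, ← Real.rpow_mul_natCast hx.le,
      show (1 + α) * n + r + 1 + p - 1 = (1 + α) * n + (r + p) by ring, Real.rpow_add hx]
    ring
  have key := hasSum_integral_of_summable_integral_norm (μ := volume.restrict (Ioc 0 x))
    (F := fun (n : ℕ) (τ : ℝ) => a n * ((x - τ) ^ (p - 1) * τ ^ ((1 + α) * n + r)))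
    (fun n => ((intervalIntegrable_iff_integrableOn_Ioc_of_le hx.le).1 (hb n)).const_mul (a n))
    (by
      refine Summable.of_nonneg_of_le (fun n => integral_nonneg fun _ => norm_nonneg _) (fun n => ?_)
        ((ha (x ^ (1 + α)) (by positivity)).mul_right
          (∫ τ in Ioc 0 x, (x - τ) ^ (p - 1) * τ ^ r))
      rw [← integral_const_mul]
      refine setIntegral_mono_on ?_ ?_ measurableSet_Ioc ?_
      · exact (((intervalIntegrable_iff_integrableOn_Ioc_of_le hx.le).1 (hb n)).const_mul (a n)).norm
      · exact (((intervalIntegrable_iff_integrableOn_Ioc_of_le hx.le).1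
          (beta_integrable hp hr hx)).const_mul _)
      · intro τ hτ
        have h1 : (0:ℝ) ≤ (x - τ) ^ (p - 1) := Real.rpow_nonneg (by linarith [hτ.2]) _
        have h2 : (0:ℝ) ≤ τ ^ r := Real.rpow_nonneg hτ.1.le _
        have h3 : τ ^ (1 + α) ≤ x ^ (1 + α) := Real.rpow_le_rpow hτ.1.le hτ.2 (by linarith)
        have h4 : (0:ℝ) ≤ τ ^ (1 + α) := Real.rpow_nonneg hτ.1.le _
        rw [Real.rpow_add hτ.1, Real.rpow_mul_natCast hτ.1.le, norm_mul, Real.norm_eq_abs,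
          Real.norm_eq_abs, abs_of_nonneg (a := (x - τ) ^ (p - 1) * _) (by positivity)]
        calc |a n| * ((x - τ) ^ (p - 1) * ((τ ^ (1 + α)) ^ n * τ ^ r))
            ≤ |a n| * ((x - τ) ^ (p - 1) * ((x ^ (1 + α)) ^ n * τ ^ r)) := by gcongr
          _ = _ := by ring)
  have h2 := key.tsum_eq
  rw [intervalIntegral.integral_of_le hx.le]
  have e : ∫ τ in Ioc 0 x, (x - τ) ^ (p - 1) * Sser α a r τ =
      ∫ τ in Ioc 0 x, ∑' n : ℕ, a n * ((x - τ) ^ (p - 1) * τ ^ ((1 + α) * n + r)) := by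
    refine setIntegral_congr_fun measurableSet_Ioc (fun τ hτ => ?_)
    simp only [Sser, Pser]
    rw [← tsum_mul_left, ← tsum_mul_left]
    refine tsum_congr (fun n => ?_)
    rw [Real.rpow_add hτ.1 ((1 + α) * n) r, Real.rpow_mul_natCast hτ.1.le]
    ring
  rw [e, ← h2]
  simp only [Sser, Pser]
  rw [← tsum_mul_left]
  refine tsum_congr (fun n => ?_)
  rw [← hval n, intervalIntegral.integral_of_le hx.le]

noncomputable def cc (α : ℝ) (n : ℕ) : ℝ := bCoef α n * (-(1 / (1 + α))) ^ n

noncomputable def dd (α : ℝ) (n : ℕ) : ℝ := -(1 + α) * (cc α (n + 1) * (n + 1))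

lemma Phi_eq (α x : ℝ) : Phi α x = Pser (cc α) (x ^ (1 + α)) := by
  unfold Phi Pser cc
  refine tsum_congr (fun n => ?_)
  rw [mul_assoc, ← mul_pow]
  congr 2
  ring

lemma bCoef_pos {α : ℝ} (hα : 0 < α) (n : ℕ) : 0 < bCoef α n := by
  unfold bCoef
  refine Finset.prod_pos (fun i _ => div_pos (Real.Gamma_pos_of_pos (by positivity))
    (Real.Gamma_pos_of_pos (by positivity)))

lemma bCoef_succ (α : ℝ) (n : ℕ) : bCoef α (n + 1) =
    bCoef α n * (Real.Gamma ((1 + α) * n + 2) / Real.Gamma ((1 + α) * n + 2 + α)) := by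
  unfold bCoef
  rw [Finset.prod_range_succ]
  congr 3 <;> ring

lemma cc_succ {α : ℝ} (hα : 0 < α) (n : ℕ) :
    cc α (n + 1) * Real.Gamma ((1 + α) * n + 2 + α) =
      -(1 / (1 + α)) * (cc α n * Real.Gamma ((1 + α) * n + 2)) := by
  have h : Real.Gamma ((1 + α) * n + 2 + α) ≠ 0 := (Real.Gamma_pos_of_pos (by positivity)).ne'
  unfold cc
  rw [bCoef_succ, pow_succ]
  field_simp

lemma gamma_ratio_le {α m : ℝ} (hα : 0 < α) (hα1 : α < 1) (hm : 1 ≤ m) :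
    Real.Gamma m / Real.Gamma (m + α) ≤ 2 * m ^ (-α) := by
  have hm0 : 0 < m := by linarith
  have hG : 0 < Real.Gamma (m + α) := Real.Gamma_pos_of_pos (by linarith)
  have h := Real.Gamma_mul_add_mul_le_rpow_Gamma_mul_rpow_Gamma (s := m + α) (t := m + α + 1)
    (a := α) (b := 1 - α) (by linarith) (by linarith) hα (by linarith) (by ring)
  rw [show α * (m + α) + (1 - α) * (m + α + 1) = m + 1 by ring, Real.Gamma_add_one hm0.ne',
    Real.Gamma_add_one (by linarith), Real.mul_rpow (by linarith) hG.le] at h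
  have h2 : Real.Gamma (m + α) ^ α * ((m + α) ^ (1 - α) * Real.Gamma (m + α) ^ (1 - α)) =
      (m + α) ^ (1 - α) * Real.Gamma (m + α) := by
    have : Real.Gamma (m + α) ^ α * Real.Gamma (m + α) ^ (1 - α) = Real.Gamma (m + α) := by
      rw [← Real.rpow_add hG]; simp
    calc _ = (m + α) ^ (1 - α) * (Real.Gamma (m + α) ^ α * Real.Gamma (m + α) ^ (1 - α)) := by ring
      _ = _ := by rw [this]
  rw [h2] at h
  have h3 : (m + α) ^ (1 - α) ≤ 2 * m ^ (1 - α) := by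
    calc (m + α) ^ (1 - α) ≤ (2 * m) ^ (1 - α) :=
          Real.rpow_le_rpow (by linarith) (by linarith) (by linarith)
      _ = 2 ^ (1 - α) * m ^ (1 - α) := Real.mul_rpow (by norm_num) hm0.le
      _ ≤ 2 * m ^ (1 - α) := by
          gcongr
          calc (2:ℝ) ^ (1 - α) ≤ 2 ^ (1:ℝ) :=
                Real.rpow_le_rpow_of_exponent_le (by norm_num) (by linarith)
            _ = 2 := by simp
  rw [div_le_iff₀ hG]
  have h4 : m ^ (1 - α) = m * m ^ (-α) := by
    rw [sub_eq_add_neg, Real.rpow_add hm0, Real.rpow_one]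
  have h5 : m * Real.Gamma m ≤ m * (2 * m ^ (-α) * Real.Gamma (m + α)) := by
    calc m * Real.Gamma m ≤ (m + α) ^ (1 - α) * Real.Gamma (m + α) := h
      _ ≤ (2 * m ^ (1 - α)) * Real.Gamma (m + α) := by gcongr
      _ = _ := by rw [h4]; ring
  exact le_of_mul_le_mul_left h5 hm0

lemma gamma_ratio_tendsto {α : ℝ} (hα : 0 < α) (hα1 : α < 1) :
    Tendsto (fun n : ℕ => Real.Gamma ((1 + α) * n + 2) / Real.Gamma ((1 + α) * n + 2 + α))
      atTop (𝓝 0) := by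
  have h1 : Tendsto (fun n : ℕ => (1 + α) * (n : ℝ) + 2) atTop atTop :=
    tendsto_atTop_add_const_right _ _
      (tendsto_natCast_atTop_atTop.const_mul_atTop (by linarith))
  have h2 := ((tendsto_rpow_neg_atTop hα).comp h1).const_mul 2
  rw [mul_zero] at h2
  refine squeeze_zero (fun n => ?_) (fun n => ?_) h2
  · exact (div_pos (Real.Gamma_pos_of_pos (by positivity))
      (Real.Gamma_pos_of_pos (by positivity))).le
  · refine gamma_ratio_le hα hα1 ?_
    have : 0 ≤ (1 + α) * n := by positivity
    linarith

lemma cc_abs_pos {α : ℝ} (hα : 0 < α) (n : ℕ) : 0 < |cc α n| := by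
  refine abs_pos.2 (mul_ne_zero (bCoef_pos hα n).ne' (pow_ne_zero _ ?_))
  have : 0 < 1 / (1 + α) := by positivity
  linarith

lemma cc_ent {α : ℝ} (hα : 0 < α) (hα1 : α < 1) : Ent (cc α) := by
  have main : ∀ R : ℝ, 0 < R → Summable fun n => |cc α n| * R ^ n := by
    intro R hR
    refine summable_of_ratio_test_tendsto_lt_one (l := 0) (by norm_num)
      (Eventually.of_forall fun n => (mul_pos (cc_abs_pos hα n) (by positivity)).ne') ?_
    have h := (gamma_ratio_tendsto hα hα1).mul_const (R / (1 + α))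
    rw [zero_mul] at h
    refine h.congr (fun n => ?_)
    have hp := cc_abs_pos hα n
    have hb := bCoef_pos hα n
    have hG : 0 < Real.Gamma ((1 + α) * n + 2 + α) := Real.Gamma_pos_of_pos (by positivity)
    have hG2 : 0 < Real.Gamma ((1 + α) * n + 2) := Real.Gamma_pos_of_pos (by positivity)
    have e : |cc α (n + 1)| = |cc α n| * (Real.Gamma ((1 + α) * n + 2) /
        Real.Gamma ((1 + α) * n + 2 + α)) / (1 + α) := by
      have h1 := congrArg abs (cc_succ hα n)
      rw [abs_mul, abs_mul, abs_mul, abs_neg, abs_of_pos hG, abs_of_pos hG2,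
        abs_of_pos (by positivity : 0 < 1 / (1 + α))] at h1
      field_simp at h1 ⊢
      linarith
    rw [Real.norm_of_nonneg (by positivity), Real.norm_of_nonneg (by positivity), e, pow_succ]
    field_simp
  intro R hR
  refine Summable.of_nonneg_of_le (fun n => by positivity) (fun n => ?_) (main (R + 1) (by linarith))
  gcongr
  linarith

lemma dd_ent {α : ℝ} (hα : 0 < α) (hα1 : α < 1) : Ent (dd α) := by
  have := ((cc_ent hα hα1).shift).affine (-(1 + α)) (-(1 + α))
  convert this using 2 with n
  simp only [dd]; ring

lemma dd_gamma {α : ℝ} (hα : 0 < α) (n : ℕ) :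
    dd α n * Real.Gamma ((1 + α) * n + α + 1) =
      1 / (1 + α) * (cc α n * Real.Gamma ((1 + α) * n + 2)) := by
  have h := cc_succ hα n
  have e : Real.Gamma ((1 + α) * n + 2 + α) =
      ((1 + α) * n + α + 1) * Real.Gamma ((1 + α) * n + α + 1) := by
    rw [← Real.Gamma_add_one (by positivity)]; congr 1; ring
  rw [e] at h
  unfold dd
  have h2 : -(1 + α) * (cc α (n + 1) * (n + 1)) * Real.Gamma ((1 + α) * n + α + 1) =
    -(cc α (n + 1) * (((1 + α) * n + α + 1) * Real.Gamma ((1 + α) * n + α + 1))) := by ring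
  rw [h2, h]; ring

noncomputable def ff (α x : ℝ) : ℝ := Sser α (dd α) α x

lemma Phi_hasDerivAt {α : ℝ} (hα : 0 < α) (hα1 : α < 1) (x : ℝ) :
    HasDerivAt (Phi α) (-ff α x) x := by
  have h2 := Real.hasDerivAt_rpow_const (x := x) (p := 1 + α) (Or.inr (by linarith))
  have h3 := (Pser_hasDerivAt (cc_ent hα hα1) (x ^ (1 + α))).comp x h2
  have e : Phi α = Pser (cc α) ∘ fun x => x ^ (1 + α) := by
    funext y; exact Phi_eq α y
  rw [e]
  refine h3.congr_deriv ?_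
  unfold ff Sser dd
  rw [Pser_const_mul, show (1 + α - 1) = α by ring]
  ring

lemma Phi_zero {α : ℝ} (hα : 0 < α) : Phi α 0 = 1 := by
  rw [Phi_eq, Real.zero_rpow (by linarith), Pser_zero]
  simp [cc, bCoef]

lemma ff_zero {α : ℝ} (hα : 0 < α) : ff α 0 = 0 := by
  unfold ff Sser
  rw [Real.zero_rpow hα.ne', zero_mul]

lemma ff_continuous {α : ℝ} (hα : 0 < α) (hα1 : α < 1) : Continuous (ff α) := by
  unfold ff Sser
  exact (Real.continuous_rpow_const hα.le).mul
    ((Pser_continuous (dd_ent hα hα1)).comp (Real.continuous_rpow_const (by linarith)))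

/-- the derivative of x Φ equals Φ - x f -/
lemma Sser_cc_eq {α : ℝ} (hα : 0 < α) (hα1 : α < 1) {x : ℝ} (hx : 0 < x) :
    Sser α (fun n => cc α n * ((1 + α) * n + 1)) 0 x = Phi α x - x * ff α x := by
  unfold Sser
  rw [Pser_affine (cc_ent hα hα1), ← Phi_eq, Real.rpow_zero]
  unfold ff Sser dd
  rw [Pser_const_mul]
  have e2 : x ^ (1 + α) = x ^ α * x := by
    rw [← Real.rpow_add_one hx.ne']; ring_nf
  nth_rewrite 1 [e2]
  ring

lemma identity1 {α : ℝ} (hα : 0 < α) (hα1 : α < 1) {x : ℝ} (hx : 0 < x) :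
    ∫ τ in (0:ℝ)..x, (x - τ) ^ (-α) * (-ff α τ) =
      -(Real.Gamma (1 - α) / (1 + α)) * (x * Phi α x) := by
  have h := Sser_kernel_integral (α := α) (p := 1 - α) (r := α) (x := x) hα
    (a := dd α) (a' := fun n => (Real.Gamma (1 - α) / (1 + α)) * cc α n)
    (dd_ent hα hα1) (by linarith) (by linarith) hx (by
      intro n
      have hG2 : 0 < Real.Gamma ((1 + α) * n + 2) := Real.Gamma_pos_of_pos (by positivity)
      rw [show (1 + α) * n + α + 1 + (1 - α) = (1 + α) * n + 2 by ring]
      have := dd_gamma hα n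
      field_simp at this ⊢
      linear_combination Real.Gamma (1 - α) * this)
  rw [show 1 - α - 1 = -α by ring, show α + (1 - α) = 1 by ring] at h
  simp only [mul_neg, intervalIntegral.integral_neg]
  unfold ff
  rw [h]
  unfold Sser
  rw [Pser_const_mul, ← Phi_eq, Real.rpow_one]
  ring

lemma identity2 {α : ℝ} (hα : 0 < α) (hα1 : α < 1) {x : ℝ} (hx : 0 < x) :
    ∫ τ in (0:ℝ)..x, (x - τ) ^ (-α) * Sser α (fun n => dd α n * ((1 + α) * n + α)) (α - 1) τ =
      (Real.Gamma (1 - α) / (1 + α)) * (Phi α x - x * ff α x) := by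
  have h := Sser_kernel_integral (α := α) (p := 1 - α) (r := α - 1) (x := x) hα
    (a := fun n => dd α n * ((1 + α) * n + α))
    (a' := fun n => (Real.Gamma (1 - α) / (1 + α)) * (cc α n * ((1 + α) * n + 1)))
    ((dd_ent hα hα1).affine _ _) (by linarith) (by linarith) hx (by
      intro n
      have hG2 : 0 < Real.Gamma ((1 + α) * n + 1) := Real.Gamma_pos_of_pos (by positivity)
      rw [show (1 + α) * n + (α - 1) + 1 + (1 - α) = (1 + α) * n + 1 by ring,
        show (1 + α) * n + (α - 1) + 1 = (1 + α) * n + α by ring]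
      have := dd_gamma hα n
      rw [Real.Gamma_add_one (by positivity), show (1 + α) * n + 2 = (1 + α) * n + 1 + 1 by ring,
        Real.Gamma_add_one (by positivity)] at this
      field_simp at this ⊢
      linear_combination Real.Gamma (1 - α) * this)
  rw [show 1 - α - 1 = -α by ring, show α - 1 + (1 - α) = 0 by ring] at h
  rw [h, ← Sser_cc_eq hα hα1 hx]
  unfold Sser
  rw [Pser_const_mul]
  ring

lemma identity3 {α : ℝ} (hα : 0 < α) (hα1 : α < 1) {x : ℝ} (hx : 0 < x) :
    ∫ τ in (0:ℝ)..x, (x - τ) ^ (α - 1) * Sser α (fun n => cc α n * ((1 + α) * n + 1)) 0 τ =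
      (Real.Gamma α * (1 + α)) * ff α x := by
  have h := Sser_kernel_integral (α := α) (p := α) (r := 0) (x := x) hα
    (a := fun n => cc α n * ((1 + α) * n + 1))
    (a' := fun n => (Real.Gamma α * (1 + α)) * dd α n)
    ((cc_ent hα hα1).affine _ _) (by linarith) (by linarith) hx (by
      intro n
      have hG2 : 0 < Real.Gamma ((1 + α) * n + 1 + α) := Real.Gamma_pos_of_pos (by positivity)
      rw [add_zero]
      have := dd_gamma hα n
      rw [show (1 + α) * n + α + 1 = (1 + α) * n + 1 + α by ring,
        show (1 + α) * n + 2 = (1 + α) * n + 1 + 1 by ring,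
        Real.Gamma_add_one (s := (1 + α) * n + 1) (by positivity)] at this
      field_simp at this ⊢
      linear_combination -this)
  rw [zero_add] at h
  rw [h]
  unfold ff Sser
  rw [Pser_const_mul]
  ring

lemma identity4 {α : ℝ} (hα : 0 < α) (hα1 : α < 1) {x : ℝ} (hx : 0 < x) :
    ∫ τ in (0:ℝ)..x, (x - τ) ^ (α - 1) * Sser α (cc α) 1 τ =
      (Real.Gamma α * (1 + α)) * (1 - Phi α x) := by
  have h := Sser_kernel_integral (α := α) (p := α) (r := 1) (x := x) hα
    (a := cc α)
    (a' := fun n => (-(Real.Gamma α * (1 + α))) * cc α (n + 1))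
    (cc_ent hα hα1) (by linarith) (by linarith) hx (by
      intro n
      have hG2 : 0 < Real.Gamma ((1 + α) * n + 2 + α) := Real.Gamma_pos_of_pos (by positivity)
      have := cc_succ hα n
      rw [show (1 + α) * n + 1 + 1 = (1 + α) * n + 2 by ring]
      field_simp at this ⊢
      linear_combination this)
  rw [h]
  unfold Sser
  rw [Pser_const_mul, Phi_eq, Pser_eq_zero_add (cc_ent hα hα1)]
  simp only [cc, bCoef]
  simp
  ring

lemma max_principle {α x0 : ℝ} (hα : 0 < α) (hα1 : α < 1) (hx0 : 0 < x0) {u u' : ℝ → ℝ}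
    (hc : ContinuousOn u (Icc 0 x0)) (hd : ∀ x, 0 < x → HasDerivAt u (u' x) x)
    (hpos : ∀ x ∈ Icc 0 x0, 0 ≤ u x) (h0 : u x0 = 0)
    (hint : IntervalIntegrable (fun τ => (x0 - τ) ^ (-α) * u' τ) volume 0 x0) :
    ∫ τ in (0:ℝ)..x0, (x0 - τ) ^ (-α) * u' τ ≤ -(x0 ^ (-α) * u 0) := by
  have key := intervalIntegral.integral_le_sub_of_hasDeriv_right_of_le (a := 0) (b := x0)
    (g := fun τ => (x0 - τ) ^ (-α) * u τ)
    (g' := fun τ => (-1) * (-α) * (x0 - τ) ^ (-α - 1) * u τ + (x0 - τ) ^ (-α) * u' τ)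
    (φ := fun τ => (x0 - τ) ^ (-α) * u' τ) hx0.le ?_ ?_ ?_ ?_
  · simpa [h0] using key
  · intro τ hτ
    rcases hτ.2.lt_or_eq with h | h
    · have hne : x0 - τ ≠ 0 := by linarith
      exact ((continuousAt_const.sub continuousAt_id).rpow_const
        (Or.inl hne)).continuousWithinAt.mul (hc τ hτ)
    · rw [h]
      have hO := (hd x0 hx0).isBigO_sub
      rw [Asymptotics.isBigO_iff] at hO
      obtain ⟨C, hC⟩ := hO
      rw [ContinuousWithinAt]
      simp only [h0, mul_zero]
      have h2 : Tendsto (fun τ : ℝ => C * (x0 - τ) ^ (1 - α)) (𝓝[Icc 0 x0] x0) (𝓝 0) := by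
        have : ContinuousAt (fun τ : ℝ => C * (x0 - τ) ^ (1 - α)) x0 :=
          ((continuousAt_const.sub continuousAt_id).rpow_const
            (Or.inr (by linarith))).const_mul C
        have h3 := this.tendsto
        simp only [sub_self] at h3
        rw [Real.zero_rpow (by linarith), mul_zero] at h3
        exact h3.mono_left nhdsWithin_le_nhds
      refine squeeze_zero_norm' ?_ h2
      filter_upwards [self_mem_nhdsWithin, nhdsWithin_le_nhds hC] with y hy hyC
      have hy1 : 0 ≤ x0 - y := by linarith [hy.2]
      rcases hy1.eq_or_lt with h | h
      · rw [← h, Real.zero_rpow (by linarith), Real.zero_rpow (by linarith)]; simp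
      · rw [h0, sub_zero, Real.norm_eq_abs (y - x0), abs_sub_comm, abs_of_pos h] at hyC
        rw [norm_mul, Real.norm_of_nonneg (Real.rpow_nonneg hy1 _)]
        calc (x0 - y) ^ (-α) * ‖u y‖ ≤ (x0 - y) ^ (-α) * (C * (x0 - y)) := by
              gcongr
          _ = C * (x0 - y) ^ (1 - α) := by
              rw [show 1 - α = -α + 1 by ring, Real.rpow_add_one h.ne']; ring
  · intro τ hτ
    have hne : x0 - τ ≠ 0 := by linarith [hτ.2]
    have h1 : HasDerivAt (fun τ : ℝ => x0 - τ) (-1) τ := by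
      simpa using (hasDerivAt_id τ).const_sub x0
    have h2 := h1.rpow_const (p := -α) (Or.inl hne)
    exact (h2.mul (hd τ hτ.1)).hasDerivWithinAt
  · exact (intervalIntegrable_iff_integrableOn_Icc_of_le hx0.le).1 hint
  · intro τ hτ
    have h1 : (0:ℝ) ≤ (x0 - τ) ^ (-α - 1) := Real.rpow_nonneg (by linarith [hτ.2]) _
    have h2 := hpos τ ⟨hτ.1.le, hτ.2.le⟩
    have : 0 ≤ (-1) * (-α) * (x0 - τ) ^ (-α - 1) * u τ := by
      rw [neg_one_mul, neg_neg]; positivity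
    linarith

lemma first_zero {u : ℝ → ℝ} (hc : Continuous u) {ε x1 : ℝ} (hε : 0 < ε)
    (hpos : ∀ x, 0 < x → x < ε → 0 < u x) (hx1 : 0 < x1) (h1 : u x1 ≤ 0) :
    ∃ x0, 0 < x0 ∧ u x0 = 0 ∧ ∀ x, 0 < x → x < x0 → 0 < u x := by
  have hx1ε : ε ≤ x1 := by
    by_contra h
    push Not at h
    linarith [hpos x1 hx1 h]
  set S := Icc ε x1 ∩ u ⁻¹' Iic 0
  have hS : IsCompact S := isCompact_Icc.inter_right (isClosed_Iic.preimage hc)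
  obtain ⟨x0, hx0, hmin⟩ := hS.exists_isLeast ⟨x1, ⟨hx1ε, le_rfl⟩, h1⟩
  have hx0pos : 0 < x0 := lt_of_lt_of_le hε hx0.1.1
  have hlt : ∀ x, 0 < x → x < x0 → 0 < u x := by
    intro x hx hxx
    by_contra h
    push Not at h
    have hεx : ε ≤ x := by
      by_contra h'
      push Not at h'
      linarith [hpos x hx h']
    have : x0 ≤ x := hmin ⟨⟨hεx, by linarith [hx0.1.2]⟩, h⟩
    linarith
  refine ⟨x0, hx0pos, le_antisymm hx0.2 ?_, hlt⟩
  have ht : Tendsto u (𝓝[<] x0) (𝓝 (u x0)) := hc.continuousAt.tendsto.mono_left nhdsWithin_le_nhds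
  refine ge_of_tendsto ht ?_
  filter_upwards [Ioo_mem_nhdsLT hx0pos] with y hy
  exact (hlt y hy.1 hy.2).le

lemma Phi_continuous {α : ℝ} (hα : 0 < α) (hα1 : α < 1) : Continuous (Phi α) :=
  continuous_iff_continuousAt.2 fun x => (Phi_hasDerivAt hα hα1 x).continuousAt

lemma Phi_pos {α : ℝ} (hα : 0 < α) (hα1 : α < 1) {x : ℝ} (hx : 0 < x) : 0 < Phi α x := by
  by_contra hneg
  push Not at hneg
  have hcont := Phi_continuous hα hα1
  have hev : ∀ᶠ y in 𝓝 (0:ℝ), 0 < Phi α y :=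
    hcont.continuousAt.eventually_const_lt (by rw [Phi_zero hα]; norm_num)
  obtain ⟨ε, hε, hball⟩ := Metric.eventually_nhds_iff.1 hev
  obtain ⟨x0, hx0, hz, hlt⟩ := first_zero hcont hε (fun y hy hyε => hball (by
    rw [Real.dist_eq, sub_zero, abs_of_pos hy]; exact hyε)) hx hneg
  have hint := Sser_kernel_integrable (α := α) (p := 1 - α) (r := α) (x := x0) hα
    (dd_ent hα hα1) (by linarith) (by linarith) hx0
  rw [show 1 - α - 1 = -α by ring] at hint
  have h := max_principle hα hα1 hx0 (u := Phi α) (u' := fun x => -ff α x) hcont.continuousOn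
    (fun x _ => Phi_hasDerivAt hα hα1 x) (fun y hy => by
      rcases hy.1.eq_or_lt with h | h
      · rw [← h, Phi_zero hα]; norm_num
      rcases hy.2.eq_or_lt with h' | h'
      · rw [h', hz]
      · exact (hlt y h h').le) hz (by
      have := hint.neg
      refine this.congr (fun τ _ => ?_)
      simp [ff])
  rw [identity1 hα hα1 hx0, hz, Phi_zero hα] at h
  have : 0 < x0 ^ (-α) := Real.rpow_pos_of_pos hx0 _
  linarith

lemma dd_zero_pos {α : ℝ} (hα : 0 < α) : 0 < dd α 0 := by
  have h := dd_gamma hα 0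
  have h1 : 0 < Real.Gamma ((1 + α) * (0:ℕ) + α + 1) := Real.Gamma_pos_of_pos (by simp; positivity)
  have h2 : 0 < Real.Gamma ((1 + α) * (0:ℕ) + 2) := Real.Gamma_pos_of_pos (by simp)
  have h3 : cc α 0 = 1 := by simp [cc, bCoef]
  rw [h3] at h
  have : 0 < dd α 0 * Real.Gamma ((1 + α) * (0:ℕ) + α + 1) := by rw [h]; positivity
  exact pos_of_mul_pos_left this h1.le

lemma ff_pos {α : ℝ} (hα : 0 < α) (hα1 : α < 1) {x : ℝ} (hx : 0 < x) : 0 < ff α x := by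
  by_contra hneg
  push Not at hneg
  have hcont := ff_continuous hα hα1
  have hcQ : Continuous (fun y : ℝ => Pser (dd α) (y ^ (1 + α))) :=
    (Pser_continuous (dd_ent hα hα1)).comp (Real.continuous_rpow_const (by linarith))
  have hev : ∀ᶠ y in 𝓝 (0:ℝ), 0 < Pser (dd α) (y ^ (1 + α)) :=
    hcQ.continuousAt.eventually_const_lt (by
      beta_reduce
      rw [Real.zero_rpow (by linarith), Pser_zero]; exact dd_zero_pos hα)
  obtain ⟨ε, hε, hball⟩ := Metric.eventually_nhds_iff.1 hev
  obtain ⟨x0, hx0, hz, hlt⟩ := first_zero hcont hε (fun y hy hyε => mul_pos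
    (Real.rpow_pos_of_pos hy _) (hball (by
    rw [Real.dist_eq, sub_zero, abs_of_pos hy]; exact hyε))) hx hneg
  have hint := Sser_kernel_integrable (α := α) (p := 1 - α) (r := α - 1) (x := x0) hα
    ((dd_ent hα hα1).affine (1 + α) α) (by linarith) (by linarith) hx0
  rw [show 1 - α - 1 = -α by ring] at hint
  have h := max_principle hα hα1 hx0 (u := ff α) hcont.continuousOn
    (fun x hx => Sser_hasDerivAt (dd_ent hα hα1) α hx) (fun y hy => by
      rcases hy.1.eq_or_lt with h | h
      · rw [← h, ff_zero hα]
      rcases hy.2.eq_or_lt with h' | h'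
      · rw [h', hz]
      · exact (hlt y h h').le) hz hint
  rw [identity2 hα hα1 hx0, hz, ff_zero hα] at h
  have h1 := Phi_pos hα hα1 hx0
  have h2 : 0 < Real.Gamma (1 - α) := Real.Gamma_pos_of_pos (by linarith)
  have : 0 < Real.Gamma (1 - α) / (1 + α) * (Phi α x0 - x0 * 0) := by
    rw [mul_zero, sub_zero]; positivity
  linarith

lemma Phi_nonneg {α : ℝ} (hα : 0 < α) (hα1 : α < 1) {x : ℝ} (hx : 0 ≤ x) : 0 ≤ Phi α x := by
  rcases hx.eq_or_lt with h | h
  · rw [← h, Phi_zero hα]; norm_num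
  · exact (Phi_pos hα hα1 h).le

lemma ff_nonneg {α : ℝ} (hα : 0 < α) (hα1 : α < 1) {x : ℝ} (hx : 0 ≤ x) : 0 ≤ ff α x := by
  rcases hx.eq_or_lt with h | h
  · rw [← h, ff_zero hα]
  · exact (ff_pos hα hα1 h).le

lemma Phi_le_one {α : ℝ} (hα : 0 < α) (hα1 : α < 1) {x : ℝ} (hx : 0 ≤ x) : Phi α x ≤ 1 := by
  have h : AntitoneOn (Phi α) (Ici 0) := by
    refine antitoneOn_of_deriv_nonpos (convex_Ici 0) (Phi_continuous hα hα1).continuousOn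
      (fun y _ => (Phi_hasDerivAt hα hα1 y).differentiableAt.differentiableWithinAt) (fun y hy => ?_)
    rw [interior_Ici] at hy
    rw [(Phi_hasDerivAt hα hα1 y).deriv]
    linarith [ff_pos hα hα1 hy]
  have := h (mem_Ici.2 (le_refl (0:ℝ))) hx hx
  rwa [Phi_zero hα] at this

lemma kernel_integrable {α x : ℝ} (hα : 0 < α) (a b : ℝ) :
    IntervalIntegrable (fun τ : ℝ => (x - τ) ^ (α - 1)) volume a b := by
  have := (intervalIntegral.intervalIntegrable_rpow' (a := x - a) (b := x - b) (r := α - 1)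
        (by linarith)).comp_sub_left x
  simpa using this

lemma kernel_integral {α x : ℝ} (hα : 0 < α) :
    ∫ τ in (0:ℝ)..x, (x - τ) ^ (α - 1) = x ^ α / α := by
  rw [intervalIntegral.integral_comp_sub_left (fun y => y ^ (α - 1)) x,
    integral_rpow (Or.inl (by linarith))]
  simp [Real.zero_rpow hα.ne']

lemma ff_le_two {α : ℝ} (hα : 0 < α) (hα1 : α < 1) {x : ℝ} (hx : 0 < x) : ff α x ≤ 2 := by
  have hG : 0 < Real.Gamma α := Real.Gamma_pos_of_pos hα
  have hΓ2 : 1 ≤ Real.Gamma (α + 1) * (1 + α) := by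
    have h := Real.Gamma_strictMonoOn_Ici.monotoneOn (a := 2) (b := α + 1 + 1) (by simp)
      (by simp; linarith) (by linarith)
    rw [Real.Gamma_add_one (by linarith), Real.Gamma_two] at h
    linarith
  rw [Real.Gamma_add_one hα.ne'] at hΓ2
  have hinv : 1 / α ≤ Real.Gamma α * (1 + α) := by
    rw [div_le_iff₀ hα]; linarith
  have hPc := Phi_continuous hα hα1
  -- the kernel times Phi
  have hK : ∀ a b, IntervalIntegrable (fun τ : ℝ => (x - τ) ^ (α - 1) * Phi α τ) volume a b :=
    fun a b => (kernel_integrable hα a b).mul_continuousOn hPc.continuousOn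
  have hKτ : ∀ a b, IntervalIntegrable (fun τ : ℝ => (x - τ) ^ (α - 1) * (τ * Phi α τ))
      volume a b :=
    fun a b => (kernel_integrable hα a b).mul_continuousOn (continuous_id.mul hPc).continuousOn
  have hknn : ∀ τ, τ ≤ x → 0 ≤ (x - τ) ^ (α - 1) := fun τ h => Real.rpow_nonneg (by linarith) _
  have h3 : (Real.Gamma α * (1 + α)) * ff α x ≤ ∫ τ in (0:ℝ)..x, (x - τ) ^ (α - 1) * Phi α τ := by
    rw [← identity3 hα hα1 hx]
    refine intervalIntegral.integral_mono_on_of_le_Ioo hx.le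
      (Sser_kernel_integrable hα ((cc_ent hα hα1).affine _ _) hα (by norm_num) hx) (hK 0 x)
      (fun τ hτ => ?_)
    rw [Sser_cc_eq hα hα1 hτ.1]
    have h1 := hknn τ hτ.2.le
    have h2 := mul_nonneg hτ.1.le (ff_pos hα hα1 hτ.1).le
    gcongr
    linarith
  have h4 : ∫ τ in (0:ℝ)..x, (x - τ) ^ (α - 1) * (τ * Phi α τ) ≤ Real.Gamma α * (1 + α) := by
    have h := identity4 hα hα1 hx
    have e : ∫ τ in (0:ℝ)..x, (x - τ) ^ (α - 1) * Sser α (cc α) 1 τ =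
        ∫ τ in (0:ℝ)..x, (x - τ) ^ (α - 1) * (τ * Phi α τ) := by
      refine intervalIntegral.integral_congr (fun τ _ => ?_)
      simp only [Sser, Real.rpow_one, Phi_eq]
    rw [← e, h]
    have := Phi_pos hα hα1 hx
    have h5 : 0 < Real.Gamma α * (1 + α) := by positivity
    nlinarith
  -- bound on [0, min x 1]
  have hsmall : ∀ c, 0 < c → c ≤ 1 → c ≤ x →
      ∫ τ in (0:ℝ)..c, (x - τ) ^ (α - 1) * Phi α τ ≤ Real.Gamma α * (1 + α) := by
    intro c hc hc1 hcx
    calc ∫ τ in (0:ℝ)..c, (x - τ) ^ (α - 1) * Phi α τ ≤ ∫ τ in (0:ℝ)..c, (c - τ) ^ (α - 1) := by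
          refine intervalIntegral.integral_mono_on_of_le_Ioo hc.le (hK 0 c)
            (kernel_integrable hα 0 c) (fun τ hτ => ?_)
          have h1 := Phi_le_one hα hα1 hτ.1.le
          have h2 : (x - τ) ^ (α - 1) ≤ (c - τ) ^ (α - 1) :=
            Real.rpow_le_rpow_of_nonpos (by linarith [hτ.2]) (by linarith) (by linarith)
          have h5 := hknn τ (by linarith [hτ.2])
          nlinarith
      _ = c ^ α / α := kernel_integral hα
      _ ≤ 1 / α := by
          gcongr
          exact Real.rpow_le_one hc.le hc1 hα.le
      _ ≤ _ := hinv
  have hfin : ∫ τ in (0:ℝ)..x, (x - τ) ^ (α - 1) * Phi α τ ≤ 2 * (Real.Gamma α * (1 + α)) := by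
    rcases le_or_gt x 1 with hx1 | hx1
    · have := hsmall x hx hx1 le_rfl
      have h5 : 0 < Real.Gamma α * (1 + α) := by positivity
      linarith
    · rw [← intervalIntegral.integral_add_adjacent_intervals (hK 0 1) (hK 1 x)]
      have h5 := hsmall 1 one_pos le_rfl hx1.le
      have h6 : ∫ τ in (1:ℝ)..x, (x - τ) ^ (α - 1) * Phi α τ ≤
          ∫ τ in (1:ℝ)..x, (x - τ) ^ (α - 1) * (τ * Phi α τ) := by
        refine intervalIntegral.integral_mono_on hx1.le (hK 1 x) (hKτ 1 x) (fun τ hτ => ?_)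
        have h1 := hknn τ hτ.2
        have h2 := Phi_nonneg hα hα1 (zero_le_one.trans hτ.1)
        have := hτ.1
        gcongr
        nlinarith
      have h7 : 0 ≤ ∫ τ in (0:ℝ)..1, (x - τ) ^ (α - 1) * (τ * Phi α τ) := by
        refine intervalIntegral.integral_nonneg zero_le_one (fun τ hτ => ?_)
        exact mul_nonneg (hknn τ (by linarith [hτ.2]))
          (mul_nonneg hτ.1 (Phi_nonneg hα hα1 hτ.1))
      rw [← intervalIntegral.integral_add_adjacent_intervals (hKτ 0 1) (hKτ 1 x)] at h4
      linarith
  have h5 : 0 < Real.Gamma α * (1 + α) := by positivity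
  have h8 : (Real.Gamma α * (1 + α)) * ff α x ≤ (Real.Gamma α * (1 + α)) * 2 := by linarith
  exact le_of_mul_le_mul_left h8 h5

lemma Phi_lipschitz {α : ℝ} (hα : 0 < α) (hα1 : α < 1) {a b : ℝ} (ha : 0 ≤ a) (hb : 0 ≤ b) :
    |Phi α a - Phi α b| ≤ 2 * |a - b| := by
  have h := Convex.norm_image_sub_le_of_norm_hasDerivWithin_le (f := Phi α) (s := Ici (0:ℝ))
    (f' := fun x => -ff α x) (C := 2) (x := b) (y := a)
    (fun x _ => (Phi_hasDerivAt hα hα1 x).hasDerivWithinAt) (fun x hx => by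
      rw [norm_neg, Real.norm_of_nonneg (ff_nonneg hα hα1 hx)]
      rcases (show (0:ℝ) ≤ x from hx).eq_or_lt with h | h
      · rw [← h, ff_zero hα]; norm_num
      · exact ff_le_two hα hα1 h) (convex_Ici 0) hb ha
  simpa [Real.norm_eq_abs] using h

lemma two_le_C1 {α : ℝ} (hα : 0 < α) (hα1 : α < 1) : 2 ≤ C1 α := by
  have hi : ∫ u in (1/2:ℝ)..1, (1 - u) ^ (α - 1) = (1/2) ^ α / α := by
    rw [intervalIntegral.integral_comp_sub_left (fun y => y ^ (α - 1)) 1,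
      integral_rpow (Or.inl (by linarith))]
    norm_num [Real.zero_rpow hα.ne']
  have hle : (1/2:ℝ) ^ α / α ≤ ∫ u in (1/2:ℝ)..1, u ^ (-(1+α)) * (1-u) ^ (α-1) := by
    rw [← hi]
    refine intervalIntegral.integral_mono_on (by norm_num) (kernel_integrable hα _ _) ?_ ?_
    · refine (kernel_integrable hα _ _).continuousOn_mul ?_
      rw [uIcc_of_le (by norm_num)]
      intro u hu
      have : u ≠ 0 := by have := hu.1; linarith
      exact (continuousAt_id.rpow_const (Or.inl this)).continuousWithinAt
    · intro u hu
      have h1 : (0:ℝ) ≤ (1 - u) ^ (α - 1) := Real.rpow_nonneg (by linarith [hu.2]) _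
      have h2 : 1 ≤ u ^ (-(1+α)) :=
        Real.one_le_rpow_of_pos_of_le_one_of_nonpos (by linarith [hu.1]) hu.2 (by linarith)
      nlinarith
  unfold C1
  have h2 : α * (2:ℝ) ^ (1+α) * ((1/2) ^ α / α) = 2 := by
    rw [Real.rpow_add (by norm_num), Real.rpow_one, one_div, Real.inv_rpow (by norm_num)]
    field_simp
  calc (2:ℝ) = α * (2:ℝ) ^ (1+α) * ((1/2) ^ α / α) := h2.symm
    _ ≤ _ := by
      gcongr
      exact hle.trans (le_max_left _ _)

lemma a0_nonneg {α : ℝ} (hα : 0 < α) (hα1 : α < 1) : 0 ≤ a0 α := by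
  unfold a0
  have : 0 ≤ ∫ x in Set.Ioi (0:ℝ), Phi α x :=
    setIntegral_nonneg measurableSet_Ioi (fun x hx => (Phi_pos hα hα1 hx).le)
  positivity

lemma fundSol_diff {α : ℝ} (hα : 0 < α) (hα1 : α < 1) {t : ℝ} (ht : 0 < t) {x y d : ℝ}
    (hd : |(|x| - |y|)| ≤ d) :
    |fundSol α t x - fundSol α t y| ≤ a0 α * C1 α * t ^ (-2/(1+α)) * d := by
  have hs : 0 < t ^ (-1/(1+α)) := Real.rpow_pos_of_pos ht _
  have hs2 : t ^ (-2/(1+α)) = t ^ (-1/(1+α)) * t ^ (-1/(1+α)) := by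
    rw [← Real.rpow_add ht]; congr 1; ring
  rw [hs2]
  unfold fundSol
  set s := t ^ (-1/(1+α))
  have ha := a0_nonneg hα hα1
  have hC := two_le_C1 hα hα1
  have hL := Phi_lipschitz hα hα1 (a := |x| * s) (b := |y| * s) (by positivity) (by positivity)
  rw [← sub_mul, abs_mul, abs_of_pos hs] at hL
  rw [← mul_sub, abs_mul, abs_of_nonneg (by positivity : 0 ≤ a0 α * s)]
  have hd0 : 0 ≤ d := (abs_nonneg _).trans hd
  calc a0 α * s * |Phi α (|x| * s) - Phi α (|y| * s)|
      ≤ a0 α * s * (C1 α * (d * s)) := by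
        gcongr
        refine hL.trans ?_
        gcongr
    _ = _ := by ring

lemma fundSol_continuous {α : ℝ} (hα : 0 < α) (hα1 : α < 1) (t : ℝ) :
    Continuous (fundSol α t) := by
  unfold fundSol
  exact ((Phi_continuous hα hα1).comp (continuous_abs.mul continuous_const)).const_mul _

lemma fundSol_bdd {α : ℝ} (hα : 0 < α) (hα1 : α < 1) {t : ℝ} (ht : 0 < t) (x : ℝ) :
    ‖fundSol α t x‖ ≤ a0 α * t ^ (-1/(1+α)) := by
  have hs : 0 < t ^ (-1/(1+α)) := Real.rpow_pos_of_pos ht _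
  unfold fundSol
  have ha := a0_nonneg hα hα1
  have h0 := Phi_nonneg hα hα1 (x := |x| * t ^ (-1/(1+α))) (by positivity)
  have h1 := Phi_le_one hα hα1 (x := |x| * t ^ (-1/(1+α))) (by positivity)
  rw [Real.norm_of_nonneg (by positivity)]
  exact mul_le_of_le_one_right (by positivity) h1

/-- `L^∞` decay: `‖w₁(·,t)‖_∞` and `‖w₂(·,t) − 2m𝔈_t‖_∞` are bounded by
`C₂(α) t^{−2/(1+α)} ‖y g(y)‖_{L¹}`. -/
theorem stmt15 (α : ℝ) (hα : α ∈ Set.Ioo (0:ℝ) 1) (g : ℝ → ℝ)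
    (hg : IntegrableOn g (Set.Ioi 0))
    (hyg : IntegrableOn (fun y => y * g y) (Set.Ioi 0))
    (hsupp : HasCompactSupport g)
    (t : ℝ) (ht : 1 < t) :
    eLpNorm (fun x => ∫ y in Set.Ioi (0:ℝ),
          (fundSol α t (x - y) - fundSol α t (x + y)) * g y) ⊤
        (volume.restrict (Set.Ioi 0)) ≤
      ENNReal.ofReal (C2 α * t ^ (-2/(1+α)) * ∫ y in Set.Ioi (0:ℝ), |y * g y|) ∧
    eLpNorm (fun x => (∫ y in Set.Ioi (0:ℝ),
          (fundSol α t (x - y) + fundSol α t (x + y)) * g y) -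
          2 * (∫ y in Set.Ioi (0:ℝ), g y) * fundSol α t x) ⊤
        (volume.restrict (Set.Ioi 0)) ≤
      ENNReal.ofReal (C2 α * t ^ (-2/(1+α)) * ∫ y in Set.Ioi (0:ℝ), |y * g y|) := by
  obtain ⟨hα0, hα1⟩ := hα
  have ht0 : 0 < t := by linarith
  have hint : Integrable (fun y => |y * g y|) (volume.restrict (Ioi (0:ℝ))) := hyg.abs
  have key : ∀ F : ℝ → ℝ, (∀ y, 0 < y → |F y| ≤ a0 α * C1 α * t ^ (-2/(1+α)) * (2 * y)) →
      ‖∫ y in Ioi (0:ℝ), F y * g y‖ ≤ C2 α * t ^ (-2/(1+α)) * ∫ y in Ioi (0:ℝ), |y * g y| := by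
    intro F hF
    rw [← integral_const_mul]
    refine norm_integral_le_of_norm_le (hint.const_mul _) ?_
    refine (ae_restrict_iff' measurableSet_Ioi).2 (Eventually.of_forall fun y hy => ?_)
    have hy0 : (0:ℝ) < y := hy
    rw [norm_mul, Real.norm_eq_abs, Real.norm_eq_abs, abs_mul, abs_of_pos hy0]
    calc |F y| * |g y| ≤ (a0 α * C1 α * t ^ (-2/(1+α)) * (2 * y)) * |g y| := by
          gcongr; exact hF y hy0
      _ = _ := by unfold C2; ring
  constructor
  · rw [eLpNorm_exponent_top]
    refine eLpNormEssSup_le_of_ae_bound (Eventually.of_forall fun x => ?_)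
    refine key _ (fun y hy => fundSol_diff hα0 hα1 ht0 ?_)
    refine (abs_abs_sub_abs_le _ _).trans ?_
    rw [show x - y - (x + y) = -(2 * y) by ring, abs_neg, abs_of_pos (by linarith)]
  · rw [eLpNorm_exponent_top]
    refine eLpNormEssSup_le_of_ae_bound (Eventually.of_forall fun x => ?_)
    have hc := fundSol_continuous hα0 hα1 t
    have hi : Integrable (fun y => (fundSol α t (x - y) + fundSol α t (x + y)) * g y)
        (volume.restrict (Ioi (0:ℝ))) := by
      refine Integrable.bdd_mul (c := a0 α * t ^ (-1/(1+α)) + a0 α * t ^ (-1/(1+α))) hg ?_ ?_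
      · exact Continuous.aestronglyMeasurable (by fun_prop)
      · exact Eventually.of_forall fun y => (norm_add_le _ _).trans
          (add_le_add (fundSol_bdd hα0 hα1 ht0 _) (fundSol_bdd hα0 hα1 ht0 _))
    have e : (∫ y in Set.Ioi (0:ℝ), (fundSol α t (x - y) + fundSol α t (x + y)) * g y) -
          2 * (∫ y in Set.Ioi (0:ℝ), g y) * fundSol α t x =
        ∫ y in Ioi (0:ℝ), ((fundSol α t (x - y) + fundSol α t (x + y)) -
          2 * fundSol α t x) * g y := by
      rw [show 2 * (∫ y in Set.Ioi (0:ℝ), g y) * fundSol α t x =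
        ∫ y in Set.Ioi (0:ℝ), (2 * fundSol α t x) * g y by rw [integral_const_mul]; ring,
        ← integral_sub hi (hg.const_mul _)]
      congr 1
      funext y
      ring
    rw [e]
    refine key _ (fun y hy => ?_)
    have h1 := fundSol_diff hα0 hα1 ht0 (x := x - y) (y := x) (d := y)
      ((abs_abs_sub_abs_le _ _).trans (by
        rw [show x - y - x = -y by ring, abs_neg, abs_of_pos hy]))
    have h2 := fundSol_diff hα0 hα1 ht0 (x := x + y) (y := x) (d := y)
      ((abs_abs_sub_abs_le _ _).trans (by
        rw [show x + y - x = y by ring, abs_of_pos hy]))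
    calc |fundSol α t (x - y) + fundSol α t (x + y) - 2 * fundSol α t x|
        = |(fundSol α t (x - y) - fundSol α t x) + (fundSol α t (x + y) - fundSol α t x)| := by
          congr 1; ring
      _ ≤ _ := abs_add_le _ _
      _ ≤ _ := add_le_add h1 h2
      _ = _ := by ring
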